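/- Let ν be a shift-invariant ergodic probability measure on {r,s}^ℤ such that ν-almost surely no two s-labels are within distance 2 of each other (for every x, not both ζ(x) = s and ζ(x+1) = s, and not both ζ(x) = s and ζ(x+2) = s), and assume ν(ζ(0) = s) > 0. Write f_r = ν(ζ(0) = r). For the fixed-energy quenched sandpile model on the cycle C_n, define ρ_th = lim_{n→∞} sup{ρ > 0 : the probability that (η_n, ζ_n) is stabilizable is at least 1/2}, where η_n has i.i.d. Poisson(ρ) heights on C_n and ζ_n is the restriction to {0,…,n} of a ν-sample. Then this limit exists and ρ_th equals the unique positive solution ρ of ρ − (1/2)(1 − e^{−2ρ}) = ((1 − f_r)/2)(1 + e^{−2ρ})²; that is, ρ_th = ρ_tr. -/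

import Mathlib

open MeasureTheory Filter Topology

/-- Toppling labels: `r` (both particles to the right neighbor) and
`s` (one particle to each neighbor). -/
inductive Label : Type
  | r : Label
  | s : Label
deriving DecidableEq

instance : MeasurableSpace Label := ⊤

/-- One toppling at site `x` of the cycle `C_n` (vertex set `ZMod (n+1)`, indices
mod `n+1`) in environment `ζ`: site `x` loses two particles; if `ζ x = r` both go
to `x + 1`, and if `ζ x = s` one goes to each of `x - 1` and `x + 1`. -/
def cycTopple (n : ℕ) (ζ : ZMod (n + 1) → Label) (η : ZMod (n + 1) → ℕ)
    (x : ZMod (n + 1)) : ZMod (n + 1) → ℕ := fun y =>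
  (η y - if y = x then 2 else 0)
    + (if ζ x = Label.r ∧ y = x + 1 then 2 else 0)
    + (if ζ x = Label.s ∧ y = x - 1 then 1 else 0)
    + (if ζ x = Label.s ∧ y = x + 1 then 1 else 0)

/-- A legal toppling on the cycle: some unstable site topples. -/
def CycStep (n : ℕ) (ζ : ZMod (n + 1) → Label) (η η' : ZMod (n + 1) → ℕ) : Prop :=
  ∃ x, 2 ≤ η x ∧ η' = cycTopple n ζ η x

/-- A state on the cycle is stabilizable if some finite sequence of legal
topplings reaches a stable configuration (all heights `≤ 1`). -/
def CycStabilizable (n : ℕ) (η : ZMod (n + 1) → ℕ) (ζ : ZMod (n + 1) → Label) : Prop :=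
  ∃ ξ, Relation.ReflTransGen (CycStep n ζ) η ξ ∧ ∀ y, ξ y ≤ 1

section Deterministic

variable {n : ℕ}

/-- The height at `x` after every site `y` has toppled `u y` times, starting from `η`. -/
def heightAfter (ζ : ZMod (n + 1) → Label) (η : ZMod (n + 1) → ℕ) (u : ZMod (n + 1) → ℕ)
    (x : ZMod (n + 1)) : ℤ :=
  η x - 2 * u x + (if ζ (x - 1) = Label.s then 1 else 2) * u (x - 1)
    + (if ζ (x + 1) = Label.s then 1 else 0) * u (x + 1)

theorem Label.eq_r_or_eq_s (l : Label) : l = Label.r ∨ l = Label.s := by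
  cases l <;> simp

theorem ZMod.natCast_ne_zero_of_le {k : ℕ} (hk : k ≠ 0) (hn : k ≤ n) :
    ((k : ℕ) : ZMod (n + 1)) ≠ 0 := by
  intro h
  rw [ZMod.natCast_eq_zero_iff] at h
  exact hk (Nat.eq_zero_of_dvd_of_lt h (by omega))

theorem ZMod.one_ne_zero_and_two_ne_zero (hn : 4 ≤ n) :
    (1 : ZMod (n + 1)) ≠ 0 ∧ (2 : ZMod (n + 1)) ≠ 0 := by
  constructor
  · simpa using ZMod.natCast_ne_zero_of_le (n := n) (k := 1) (by omega) (by omega)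
  · simpa using ZMod.natCast_ne_zero_of_le (n := n) (k := 2) (by omega) (by omega)

theorem heightAfter_cycTopple (ζ : ZMod (n + 1) → Label) {η u : ZMod (n + 1) → ℕ}
    {x : ZMod (n + 1)} (hη : 2 ≤ η x) (hu : 1 ≤ u x) (y : ZMod (n + 1)) :
    heightAfter ζ (cycTopple n ζ η x) (u - Pi.single x 1) y = heightAfter ζ η u y := by
  have key : ∀ z, (((u - Pi.single x 1 : ZMod (n + 1) → ℕ) z : ℕ) : ℤ) =
      u z - if z = x then 1 else 0 := by
    intro z
    by_cases hz : z = x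
    · subst hz
      simp [Nat.cast_sub hu]
    · simp [hz]
  have h1 : y + 1 = x ↔ y = x - 1 := eq_sub_iff_add_eq.symm
  have h2 : y - 1 = x ↔ y = x + 1 := sub_eq_iff_eq_add
  have key2 : ((cycTopple n ζ η x y : ℕ) : ℤ) = η y - (if y = x then 2 else 0)
      + (if y - 1 = x then (if ζ (y - 1) = Label.s then 1 else 2) else 0)
      + (if y + 1 = x then (if ζ (y + 1) = Label.s then 1 else 0) else 0) := by
    have hsub : (((η y - if y = x then 2 else 0) : ℕ) : ℤ) = η y - (if y = x then 2 else 0) := by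
      by_cases hy : y = x
      · subst hy
        simp [Nat.cast_sub hη]
      · simp [hy]
    have ha : (if y - 1 = x then (if ζ (y - 1) = Label.s then (1 : ℤ) else 2) else 0) =
        if y = x + 1 then (if ζ x = Label.s then 1 else 2) else 0 := by
      by_cases h : y - 1 = x
      · simp [← h2, h]
      · simp [← h2, h]
    have hb : (if y + 1 = x then (if ζ (y + 1) = Label.s then (1 : ℤ) else 0) else 0) =
        if y = x - 1 then (if ζ x = Label.s then 1 else 0) else 0 := by
      by_cases h : y + 1 = x
      · simp [← h1, h]
      · simp [← h1, h]
    rw [ha, hb]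
    unfold cycTopple
    push_cast
    rw [hsub]
    rcases Label.eq_r_or_eq_s (ζ x) with h | h <;> simp [h]
    ring
  unfold heightAfter
  rw [key2, key, key, key]
  split_ifs <;> ring

/-- Least action principle: a (not necessarily legal) stabilizing odometer yields a legal
stabilizing sequence of topplings. -/
theorem CycStabilizable.of_heightAfter_le (ζ : ZMod (n + 1) → Label) (η u : ZMod (n + 1) → ℕ)
    (hu : ∀ x, heightAfter ζ η u x ≤ 1) : CycStabilizable n η ζ := by
  induction hN : ∑ x, u x using Nat.strong_induction_on generalizing η u with
  | _ N ih =>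
    by_cases hst : ∀ y, η y ≤ 1
    · exact ⟨η, .refl, hst⟩
    · push Not at hst
      obtain ⟨x, hx⟩ := hst
      have hux : 1 ≤ u x := by
        by_contra h
        have h0 : u x = 0 := by omega
        have := hu x
        unfold heightAfter at this
        rw [h0] at this
        have a1 : (0 : ℤ) ≤ (if ζ (x - 1) = Label.s then 1 else 2) * u (x - 1) := by positivity
        have a2 : (0 : ℤ) ≤ (if ζ (x + 1) = Label.s then 1 else 0) * u (x + 1) := by positivity
        push_cast at this
        omega
      have hle : Pi.single x 1 ≤ u := by
        intro z
        by_cases hz : z = x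
        · subst hz; simpa using hux
        · simp [hz]
      have hsum : ∑ z, (u - Pi.single x 1 : ZMod (n + 1) → ℕ) z < N := by
        rw [← hN]
        refine Finset.sum_lt_sum (fun z _ => by simp) ⟨x, Finset.mem_univ _, ?_⟩
        simp; omega
      obtain ⟨ξ, hξ, hξ1⟩ := ih _ hsum (cycTopple n ζ η x) (u - Pi.single x 1)
        (fun y => by rw [heightAfter_cycTopple ζ hx hux]; exact hu y) rfl
      exact ⟨ξ, .head ⟨x, hx, rfl⟩ hξ, hξ1⟩

/-- An `s`-site all of whose sites within distance `2` are `r`-sites. -/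
def IsIsolated (ζ : ZMod (n + 1) → Label) (x : ZMod (n + 1)) : Prop :=
  ζ x = Label.s ∧ ζ (x + 1) = Label.r ∧ ζ (x + 2) = Label.r ∧
    ζ (x - 1) = Label.r ∧ ζ (x - 2) = Label.r

open Classical in
/-- The number of isolated `s`-sites both of whose neighbors have even height. -/
noncomputable def evenPairs (ζ : ZMod (n + 1) → Label) (η : ZMod (n + 1) → ℕ) : ℕ :=
  ∑ x, if IsIsolated ζ x ∧ Even (η (x - 1)) ∧ Even (η (x + 1)) then 1 else 0

open Classical in
/-- The number of `s`-sites which are not isolated. -/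
noncomputable def defects (ζ : ZMod (n + 1) → Label) : ℕ :=
  ∑ x, if ζ x = Label.s ∧ ¬ IsIsolated ζ x then 1 else 0

theorem Fintype.sum_add_one_sub_one (f g : ZMod (n + 1) → ℤ) :
    ∑ x, (f (x - 1) + g (x + 1)) = ∑ x, (f x + g x) := by
  rw [Finset.sum_add_distrib, Finset.sum_add_distrib]
  congr 1
  · exact Equiv.sum_comp (Equiv.subRight (1 : ZMod (n + 1))) f
  · exact Equiv.sum_comp (Equiv.addRight (1 : ZMod (n + 1))) g

theorem cycTopple_parity_of_r (ζ : ZMod (n + 1) → Label) {η : ZMod (n + 1) → ℕ}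
    {x y : ZMod (n + 1)} (hη : 2 ≤ η x) (h1 : ζ (y - 1) = Label.r) (h2 : ζ (y + 1) = Label.r) :
    cycTopple n ζ η x y % 2 = η y % 2 := by
  have a : ¬ (ζ x = Label.s ∧ y = x - 1) := by
    rintro ⟨hx, rfl⟩; simp [hx] at h2
  have b : ¬ (ζ x = Label.s ∧ y = x + 1) := by
    rintro ⟨hx, rfl⟩; simp [hx] at h1
  unfold cycTopple
  rw [if_neg a, if_neg b]
  by_cases hy : y = x
  · subst hy; split_ifs <;> omega
  · simp only [hy, if_false]; split_ifs <;> omega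

theorem IsIsolated.cycTopple_parity (hn : 4 ≤ n) {ζ : ZMod (n + 1) → Label}
    {η : ZMod (n + 1) → ℕ} {x y : ZMod (n + 1)} (hη : 2 ≤ η x) (hy : IsIsolated ζ y) :
    (cycTopple n ζ η x (y - 1) + cycTopple n ζ η x (y + 1)) % 2
      = (η (y - 1) + η (y + 1)) % 2 := by
  obtain ⟨n1, n2⟩ := ZMod.one_ne_zero_and_two_ne_zero hn
  obtain ⟨h0, h1, h2, h3, h4⟩ := hy
  by_cases hxy : x = y
  · subst hxy
    have e1 : x - 1 ≠ x := by simp [sub_eq_self, n1]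
    have e2 : x + 1 ≠ x := by simp [n1]
    have e3 : x - 1 ≠ x + 1 := by
      intro h; apply n2; linear_combination -h
    simp [cycTopple, h0, e1, e2, e3, e3.symm]
    omega
  · have a : ∀ z, (z = y - 1 ∨ z = y + 1) → cycTopple n ζ η x z % 2 = η z % 2 := by
      intro z hz
      have a1 : ¬ (ζ x = Label.s ∧ z = x - 1) := by
        rintro ⟨hx, rfl⟩
        rcases hz with h | h
        · exact hxy (by linear_combination h)
        · have : x = y + 2 := by linear_combination h
          simp [this, h2] at hx
      have b1 : ¬ (ζ x = Label.s ∧ z = x + 1) := by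
        rintro ⟨hx, rfl⟩
        rcases hz with h | h
        · have : x = y - 2 := by linear_combination h
          simp [this, h4] at hx
        · exact hxy (by linear_combination h)
      unfold cycTopple
      rw [if_neg a1, if_neg b1]
      by_cases hz : z = x
      · subst hz; split_ifs <;> omega
      · simp only [hz, if_false]; split_ifs <;> omega
    rw [Nat.add_mod, a _ (.inl rfl), a _ (.inr rfl), ← Nat.add_mod]

theorem sum_cycTopple (ζ : ZMod (n + 1) → Label) {η : ZMod (n + 1) → ℕ}
    {x : ZMod (n + 1)} (hη : 2 ≤ η x) : ∑ y, cycTopple n ζ η x y = ∑ y, η y := by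
  have h : ∀ y, cycTopple n ζ η x y + (if y = x then 2 else 0) = η y
      + (if ζ x = Label.r ∧ y = x + 1 then 2 else 0)
      + (if ζ x = Label.s ∧ y = x - 1 then 1 else 0)
      + (if ζ x = Label.s ∧ y = x + 1 then 1 else 0) := by
    intro y
    unfold cycTopple
    by_cases hy : y = x
    · subst hy; simp only [if_true]; omega
    · simp only [hy, if_false]; omega
  have hs := Finset.sum_congr rfl (fun y (_ : y ∈ Finset.univ) => h y)
  simp only [Finset.sum_add_distrib] at hs
  rcases Label.eq_r_or_eq_s (ζ x) with hl | hl <;> simp [hl] at hs <;> omega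

/-- A stabilizable configuration cannot carry more pairs of particles than the isolated
`s`-sites (and the defects) can absorb. -/
theorem CycStabilizable.sum_div_two_le (hn : 4 ≤ n) {ζ : ZMod (n + 1) → Label}
    {η : ZMod (n + 1) → ℕ} (h : CycStabilizable n η ζ) :
    ∑ x, η x / 2 ≤ evenPairs ζ η + defects ζ := by
  classical
  obtain ⟨ξ, hξ, hst⟩ := h
  have inv : ∑ y, ξ y = ∑ y, η y ∧
      (∀ y, ζ (y - 1) = Label.r → ζ (y + 1) = Label.r → ξ y % 2 = η y % 2) ∧
      (∀ y, IsIsolated ζ y → (ξ (y - 1) + ξ (y + 1)) % 2 = (η (y - 1) + η (y + 1)) % 2) := by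
    clear hst
    induction hξ with
    | refl => simp
    | tail _ hstep ih =>
      obtain ⟨x, hx, rfl⟩ := hstep
      obtain ⟨i1, i2, i3⟩ := ih
      refine ⟨(sum_cycTopple ζ hx).trans i1, fun y a b => ?_, fun y a => ?_⟩
      · rw [cycTopple_parity_of_r ζ hx a b, i2 y a b]
      · rw [a.cycTopple_parity hn hx, i3 y a]
  obtain ⟨i1, i2, i3⟩ := inv
  let D : ZMod (n + 1) → ℤ := fun x => ξ x - (η x % 2 : ℕ)
  have hD : ∑ x, D x = 2 * ((∑ x, η x / 2 : ℕ) : ℤ) := by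
    simp only [D, Finset.sum_sub_distrib]
    rw [← Nat.cast_sum, i1, Nat.cast_sum, ← Finset.sum_sub_distrib, Nat.cast_sum,
      Finset.mul_sum]
    refine Finset.sum_congr rfl fun x _ => ?_
    omega
  have pt : ∀ x, D x ≤
      ((if IsIsolated ζ (x - 1) then D ((x - 1) + 1) else 0) +
          (if ζ (x - 1) = Label.s ∧ ¬ IsIsolated ζ (x - 1) then 1 else 0)) +
        ((if IsIsolated ζ (x + 1) then D ((x + 1) - 1) else 0) +
          (if ζ (x + 1) = Label.s ∧ ¬ IsIsolated ζ (x + 1) then 1 else 0)) := by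
    intro x
    have hx1 : D x ≤ 1 := by
      have := hst x
      simp only [D]; omega
    rw [sub_add_cancel, add_sub_cancel_right]
    by_cases h1 : IsIsolated ζ (x - 1)
    · have h2 : ζ (x + 1) = Label.r := by
        have := h1.2.2.1
        rwa [show x - 1 + 2 = x + 1 by ring] at this
      have h3 : ¬ IsIsolated ζ (x + 1) := fun h => by simp [h.1] at h2
      simp [h1, h2, h3]
    · by_cases h3 : IsIsolated ζ (x + 1)
      · have h2 : ζ (x - 1) = Label.r := by
          have := h3.2.2.2.2
          rwa [show x + 1 - 2 = x - 1 by ring] at this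
        simp [h1, h2, h3]
      · simp only [h1, h3, if_false, not_false_eq_true, and_true, zero_add]
        rcases Label.eq_r_or_eq_s (ζ (x - 1)) with a | a <;>
          rcases Label.eq_r_or_eq_s (ζ (x + 1)) with b | b
        · have := i2 x a b
          have := hst x
          simp only [a, b, D]
          simp
          omega
        all_goals simp [a, b]; omega
  have tot := Finset.sum_le_sum (fun x (_ : x ∈ Finset.univ) => pt x)
  rw [hD, Fintype.sum_add_one_sub_one
    (fun x => (if IsIsolated ζ x then D (x + 1) else 0) +
      (if ζ x = Label.s ∧ ¬ IsIsolated ζ x then 1 else 0))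
    (fun x => (if IsIsolated ζ x then D (x - 1) else 0) +
      (if ζ x = Label.s ∧ ¬ IsIsolated ζ x then 1 else 0))] at tot
  have pt2 : ∀ x, ((if IsIsolated ζ x then D (x + 1) else 0) +
        (if ζ x = Label.s ∧ ¬ IsIsolated ζ x then 1 else 0)) +
      ((if IsIsolated ζ x then D (x - 1) else 0) +
        (if ζ x = Label.s ∧ ¬ IsIsolated ζ x then 1 else 0)) ≤
      2 * ((if IsIsolated ζ x ∧ Even (η (x - 1)) ∧ Even (η (x + 1)) then 1 else 0) +
        (if ζ x = Label.s ∧ ¬ IsIsolated ζ x then 1 else 0)) := by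
    intro x
    by_cases h1 : IsIsolated ζ x
    · have e := i3 x h1
      have a := hst (x - 1)
      have b := hst (x + 1)
      simp only [h1, if_true, true_and, not_true, and_false, if_false, D, Nat.even_iff]
      split_ifs <;> omega
    · simp only [h1, if_false, false_and]
      split_ifs <;> simp
  have tot2 := tot.trans (Finset.sum_le_sum (fun x (_ : x ∈ Finset.univ) => pt2 x))
  rw [← Finset.mul_sum, Finset.sum_add_distrib] at tot2
  have : ((∑ x, η x / 2 : ℕ) : ℤ) ≤ ((evenPairs ζ η + defects ζ : ℕ) : ℤ) := by
    unfold evenPairs defects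
    push_cast
    push_cast at tot2
    linarith
  exact_mod_cast this

theorem ZMod.forall_of_sub_one {p : ZMod (n + 1) → Prop} (h0 : p 0)
    (hstep : ∀ x, p (x - 1) → p x) (x : ZMod (n + 1)) : p x := by
  have : ∀ k : ℕ, p (k : ZMod (n + 1)) := by
    intro k
    induction k with
    | zero => simpa using h0
    | succ k ih => exact hstep _ (by simpa using ih)
  simpa using this x.val

theorem ZMod.exists_sub_sub_one_eq (d : ZMod (n + 1) → ℤ) (hd : ∑ x, d x = 0) :
    ∃ J : ZMod (n + 1) → ℤ, ∀ x, J x - J (x - 1) = d x := by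
  have hrange : ∑ j ∈ Finset.range (n + 1), d (j : ZMod (n + 1)) = 0 := by
    rw [← hd]
    exact Finset.sum_nbij' (fun j : ℕ => (j : ZMod (n + 1))) ZMod.val (by simp)
      (fun x _ => by simpa using ZMod.val_lt x)
      (fun j hj => ZMod.val_cast_of_lt (by simpa using hj)) (by simp) (by simp)
  refine ⟨fun x => ∑ j ∈ Finset.range (x.val + 1), d (j : ZMod (n + 1)), fun x => ?_⟩
  by_cases hx : x = 0
  · subst hx
    have : (0 - 1 : ZMod (n + 1)).val = n := by simp [ZMod.val_neg_one n]
    simp only [this, hrange]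
    simp
  · have hv : x.val ≠ 0 := by simpa using hx
    have : (x - 1).val + 1 = x.val := by
      obtain ⟨k, hk⟩ := Nat.exists_eq_succ_of_ne_zero hv
      have hlt := ZMod.val_lt x
      have hxk : x - 1 = (k : ZMod (n + 1)) := by
        have : x = ((k + 1 : ℕ) : ZMod (n + 1)) := by
          rw [← ZMod.natCast_zmod_val x, hk]
        rw [this]; simp
      rw [hxk, ZMod.val_cast_of_lt (by omega), hk]
    simp only [this]
    rw [Finset.sum_range_succ]
    simp

open Classical in
/-- The parity prescribed for the net flux of particles across the edge `(x, x + 1)`. -/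
noncomputable def fluxParity (ζ : ZMod (n + 1) → Label) (η : ZMod (n + 1) → ℕ)
    (x : ZMod (n + 1)) : ℕ :=
  if IsIsolated ζ x then (η (x + 1) + 1) % 2
  else if IsIsolated ζ (x + 1) then (η (x + 2) + 1) % 2 else 0

/-- The parity of the final height when the flux across edges has parity `fluxParity`. -/
noncomputable def finalParity (ζ : ZMod (n + 1) → Label) (η : ZMod (n + 1) → ℕ)
    (x : ZMod (n + 1)) : ℕ :=
  (η x + fluxParity ζ η x + fluxParity ζ η (x - 1)) % 2

theorem IsIsolated.finalParity_add_one {ζ : ZMod (n + 1) → Label} {η : ZMod (n + 1) → ℕ}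
    {y : ZMod (n + 1)} (h : IsIsolated ζ y) : finalParity ζ η (y + 1) = 1 := by
  have h1 : ¬ IsIsolated ζ (y + 1) := fun h' => by simpa [h'.1] using h.2.1
  have h2 : ¬ IsIsolated ζ (y + 1 + 1) := fun h' => by
    have := h.2.2.1
    rw [show y + 2 = y + 1 + 1 by ring, h'.1] at this
    cases this
  simp only [finalParity, fluxParity, h1, h2, if_false, add_sub_cancel_right, h, if_true]
  omega

theorem IsIsolated.finalParity_sub_one {ζ : ZMod (n + 1) → Label} {η : ZMod (n + 1) → ℕ}
    {y : ZMod (n + 1)} (h : IsIsolated ζ y) :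
    finalParity ζ η (y - 1) = (η (y - 1) + η (y + 1) + 1) % 2 := by
  have h1 : ¬ IsIsolated ζ (y - 1) := fun h' => by simpa [h'.1] using h.2.2.2.1
  have h2 : ¬ IsIsolated ζ (y - 1 - 1) := fun h' => by
    have := h.2.2.2.2
    rw [show y - 2 = y - 1 - 1 by ring, h'.1] at this
    cases this
  simp only [finalParity, fluxParity, h1, h2, if_false, sub_add_cancel, h, if_true,
    show y - 1 + 2 = y + 1 by ring]
  omega

theorem finalParity_of_not_isolated {ζ : ZMod (n + 1) → Label} {η : ZMod (n + 1) → ℕ}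
    {x : ZMod (n + 1)} (h1 : ¬ IsIsolated ζ (x - 1)) (h2 : ¬ IsIsolated ζ (x + 1)) :
    finalParity ζ η x = η x % 2 := by
  have e : x - 1 + 2 = x + 1 := by ring
  by_cases h : IsIsolated ζ x
  · simp only [finalParity, fluxParity, h1, h, if_false, if_true, sub_add_cancel, e]
    omega
  · simp [finalParity, fluxParity, h1, h2, h]

theorem sum_finalParity (ζ : ZMod (n + 1) → Label) (η : ZMod (n + 1) → ℕ) :
    ∑ x, ((finalParity ζ η x : ℤ) - (η x % 2 : ℕ)) = 2 * (evenPairs ζ η : ℤ) := by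
  classical
  let D : ZMod (n + 1) → ℤ := fun x => finalParity ζ η x - (η x % 2 : ℕ)
  have pt : ∀ x, D x =
      (if IsIsolated ζ (x - 1) then D ((x - 1) + 1) else 0) +
        (if IsIsolated ζ (x + 1) then D ((x + 1) - 1) else 0) := by
    intro x
    rw [sub_add_cancel, add_sub_cancel_right]
    by_cases h1 : IsIsolated ζ (x - 1)
    · have h3 : ¬ IsIsolated ζ (x + 1) := fun h => by
        have := h1.2.2.1
        rw [show x - 1 + 2 = x + 1 by ring, h.1] at this
        cases this
      simp [h1, h3]
    · by_cases h3 : IsIsolated ζ (x + 1)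
      · simp [h1, h3]
      · simp [h1, h3, D, finalParity_of_not_isolated h1 h3]
  change ∑ x, D x = _
  rw [Finset.sum_congr rfl fun x _ => pt x, Fintype.sum_add_one_sub_one
    (fun x => if IsIsolated ζ x then D (x + 1) else 0)
    (fun x => if IsIsolated ζ x then D (x - 1) else 0)]
  unfold evenPairs
  push_cast
  rw [Finset.mul_sum]
  refine Finset.sum_congr rfl fun x _ => ?_
  by_cases h : IsIsolated ζ x
  · simp only [h, if_true, true_and, D, h.finalParity_add_one, h.finalParity_sub_one,
      Nat.even_iff]
    split_ifs <;> omega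
  · simp [h]

/-- If the isolated `s`-sites can absorb all pairs of particles, the configuration is
stabilizable. -/
theorem CycStabilizable.of_sum_div_two_le {ζ : ZMod (n + 1) → Label}
    {η : ZMod (n + 1) → ℕ}
    (hζ : ∀ x, ζ x = Label.s → ζ (x + 1) = Label.s → ζ (x + 2) = Label.r)
    (h : ∑ x, η x / 2 ≤ evenPairs ζ η) : CycStabilizable n η ζ := by
  classical
  let m : ℤ := (evenPairs ζ η : ℤ) - (∑ x, η x / 2 : ℕ)
  have hm : 0 ≤ m := by simp only [m]; omega
  let d : ZMod (n + 1) → ℤ := fun x => η x - finalParity ζ η x + if x = 0 then 2 * m else 0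
  have hd : ∑ x, d x = 0 := by
    have hs := sum_finalParity ζ η
    have : ∀ x, d x = 2 * ((η x / 2 : ℕ) : ℤ) - ((finalParity ζ η x : ℤ) - (η x % 2 : ℕ))
        + if x = 0 then 2 * m else 0 := by
      intro x; simp only [d]; omega
    rw [Finset.sum_congr rfl fun x _ => this x, Finset.sum_add_distrib,
      Finset.sum_sub_distrib, hs, ← Finset.mul_sum]
    simp [m]
    ring
  obtain ⟨J₀, hJ₀⟩ := ZMod.exists_sub_sub_one_eq d hd
  let C : ℤ := ∑ x, |J₀ x|
  let J : ZMod (n + 1) → ℤ := fun x =>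
    J₀ x + C + (C + J₀ 0 + fluxParity ζ η 0) % 2
  have hJ : ∀ x, J x - J (x - 1) = d x := fun x => by rw [← hJ₀ x]; simp only [J]; ring
  have hJpos : ∀ x, 0 ≤ J x := by
    intro x
    have h1 : |J₀ x| ≤ C := Finset.single_le_sum (f := fun x => |J₀ x|)
      (fun i _ => abs_nonneg _) (Finset.mem_univ x)
    have h2 := neg_abs_le (J₀ x)
    have h3 := Int.emod_nonneg (C + J₀ 0 + fluxParity ζ η 0) two_ne_zero
    simp only [J]; linarith
  have hJpar : ∀ x, (J x - fluxParity ζ η x) % 2 = 0 := by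
    refine ZMod.forall_of_sub_one ?_ fun x hx => ?_
    · simp only [J]; omega
    · have h1 := hJ x
      have h2 : (finalParity ζ η x : ℤ) =
        (η x + fluxParity ζ η x + fluxParity ζ η (x - 1)) % 2 := by
        simp [finalParity]
      simp only [d] at h1
      split_ifs at h1 <;> omega
  -- The odometer recovered from the flux `J`.
  let uS : ZMod (n + 1) → ℤ := fun x => J x + if ζ (x + 1) = Label.s then J (x + 1) else 0
  let u : ZMod (n + 1) → ℤ := fun x =>
    if ζ x = Label.s then uS x
    else (J x + if ζ (x + 1) = Label.s then uS (x + 1) else 0) / 2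
  have huS : ∀ x, 0 ≤ uS x := by
    intro x
    have := hJpos x
    have := hJpos (x + 1)
    simp only [uS]
    split_ifs <;> omega
  have hu : ∀ x, 0 ≤ u x := by
    intro x
    have := hJpos x
    have := huS x
    have := huS (x + 1)
    simp only [u]
    split_ifs <;> omega
  have hflux : ∀ x, (if ζ x = Label.s then 1 else 2) * u x
      - (if ζ (x + 1) = Label.s then 1 else 0) * u (x + 1) = J x := by
    intro x
    have e2 : x + 1 + 1 = x + 2 := by ring
    have e3 : x + 1 + 2 = x + 3 := by ring
    rcases Label.eq_r_or_eq_s (ζ x) with a | a <;>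
      rcases Label.eq_r_or_eq_s (ζ (x + 1)) with b | b
    · have h1 : ¬ IsIsolated ζ x := fun h => by simp [h.1] at a
      have h2 : ¬ IsIsolated ζ (x + 1) := fun h => by simp [h.1] at b
      have := hJpar x
      simp only [fluxParity, h1, h2, if_false] at this
      simp [u, a, b]
      omega
    · have h1 : ¬ IsIsolated ζ x := fun h => by simp [h.1] at a
      have p0 := hJpar x
      have p1 := hJpar (x + 1)
      have p2 := hJpar (x + 2)
      by_cases h2 : IsIsolated ζ (x + 1)
      · have c : ζ (x + 2) = Label.r := by rw [← e2]; exact h2.2.1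
        simp only [fluxParity, h1, h2, if_false, if_true, e3, e2] at p0 p1
        simp [u, uS, a, b, e2, c]
        omega
      · simp only [fluxParity, h1, h2, if_false, e2] at p0 p1
        have h3 : ¬ IsIsolated ζ (x + 2) := fun h => by
          have := h.2.2.2.1
          rw [show x + 2 - 1 = x + 1 by ring, b] at this
          cases this
        simp only [h3, if_false] at p1
        rcases Label.eq_r_or_eq_s (ζ (x + 2)) with c | c
        · simp [u, uS, a, b, e2, c]
          omega
        · have h4 : ¬ IsIsolated ζ (x + 2 + 1) := fun h => by
            have := h.2.2.2.1
            rw [show x + 2 + 1 - 1 = x + 2 by ring, c] at this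
            cases this
          simp only [fluxParity, h3, h4, if_false] at p2
          simp [u, uS, a, b, e2, c]
          omega
    · simp [u, uS, a, b]
    · have c := hζ x a b
      simp [u, uS, a, b, e2, c]
  refine CycStabilizable.of_heightAfter_le ζ η (fun x => (u x).toNat) fun x => ?_
  have f1 := hflux x
  have f2 := hflux (x - 1)
  have g1 := hJ x
  rw [sub_add_cancel] at f2
  have hfin : heightAfter ζ η (fun x => (u x).toNat) x = η x - d x := by
    unfold heightAfter
    rw [Int.toNat_of_nonneg (hu _), Int.toNat_of_nonneg (hu _), Int.toNat_of_nonneg (hu _),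
      ← g1, ← f1, ← f2]
    split_ifs <;> ring
  rw [hfin]
  have : finalParity ζ η x ≤ 1 := by unfold finalParity; omega
  simp only [d]
  split_ifs <;> omega

end Deterministic

section Poisson

open ProbabilityTheory NNReal

theorem Real.hasSum_poisson_pow (r z : ℝ) :
    HasSum (fun n : ℕ => Real.exp (-r) * r ^ n / n.factorial * z ^ n)
      (Real.exp (r * z - r)) := by
  have h := (NormedSpace.expSeries_div_hasSum_exp (r * z)).mul_left (Real.exp (-r))
  rw [← Real.exp_eq_exp_ℝ, ← Real.exp_add] at h
  convert! h using 1
  · ext n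
    rw [mul_pow]
    ring
  · ring_nf

theorem Real.hasSum_poisson_one (r : ℝ) :
    HasSum (fun n : ℕ => Real.exp (-r) * r ^ n / n.factorial) 1 := by
  simpa using Real.hasSum_poisson_pow r 1

theorem Real.hasSum_poisson_id (r : ℝ) :
    HasSum (fun n : ℕ => Real.exp (-r) * r ^ n / n.factorial * n) r := by
  rw [← hasSum_nat_add_iff' 1]
  convert! (Real.hasSum_poisson_one r).mul_left r using 1
  · ext n
    have : (n.factorial : ℝ) ≠ 0 := by positivity
    rw [Nat.factorial_succ]
    push_cast
    field_simp
    ring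
  · simp

theorem Real.hasSum_poisson_sq (r : ℝ) :
    HasSum (fun n : ℕ => Real.exp (-r) * r ^ n / n.factorial * (n : ℝ) ^ 2) (r ^ 2 + r) := by
  rw [← hasSum_nat_add_iff' 1]
  convert! ((Real.hasSum_poisson_id r).mul_left r).add
    ((Real.hasSum_poisson_one r).mul_left r) using 1
  · ext n
    have : (n.factorial : ℝ) ≠ 0 := by positivity
    rw [Nat.factorial_succ]
    push_cast
    field_simp
    ring
  · simp
    ring

variable {r : ℝ≥0}

theorem integral_poissonMeasure_eq_of_hasSum {f : ℕ → ℝ} {I : ℝ}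
    (h : HasSum (fun n : ℕ => Real.exp (-r) * (r : ℝ) ^ n / n.factorial * f n) I) :
    ∫ k, f k ∂(poissonMeasure r) = I := by
  rw [integral_poissonMeasure]
  simpa using h.tsum_eq

theorem integrable_sq_poissonMeasure :
    Integrable (fun k : ℕ => (k : ℝ) ^ 2) (poissonMeasure r) := by
  rw [integrable_poissonMeasure_iff]
  simpa using (Real.hasSum_poisson_sq (r : ℝ)).summable

theorem memLp_natCast_poissonMeasure : MemLp (fun k : ℕ => (k : ℝ)) 2 (poissonMeasure r) :=
  (memLp_two_iff_integrable_sq (by fun_prop)).2 integrable_sq_poissonMeasure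

theorem cast_div_two_eq (k : ℕ) :
    ((k / 2 : ℕ) : ℝ) = (k : ℝ) / 2 - 1 / 4 + (-1 : ℝ) ^ k / 4 := by
  rcases Nat.even_or_odd' k with ⟨m, rfl | rfl⟩
  · rw [pow_mul]
    simp
  · rw [pow_add, pow_mul, show (2 * m + 1) / 2 = m by omega]
    push_cast
    norm_num
    ring

theorem ite_even_eq (k : ℕ) : (if Even k then (1 : ℝ) else 0) = 1 / 2 + (-1 : ℝ) ^ k / 2 := by
  rcases Nat.even_or_odd k with h | h
  · simp [h, h.neg_one_pow]; norm_num
  · simp [Nat.not_even_iff_odd.2 h, h.neg_one_pow]; norm_num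

theorem memLp_div_two_poissonMeasure :
    MemLp (fun k : ℕ => ((k / 2 : ℕ) : ℝ)) 2 (poissonMeasure r) := by
  refine memLp_natCast_poissonMeasure.mono (by fun_prop) (ae_of_all _ fun k => ?_)
  simp only [RCLike.norm_natCast]
  exact_mod_cast Nat.div_le_self k 2

theorem integral_div_two_poissonMeasure :
    ∫ k, ((k / 2 : ℕ) : ℝ) ∂(poissonMeasure r) = r / 2 - 1 / 4 + Real.exp (-2 * r) / 4 := by
  refine integral_poissonMeasure_eq_of_hasSum ?_
  convert! (((Real.hasSum_poisson_id (r : ℝ)).div_const 2).sub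
    ((Real.hasSum_poisson_one (r : ℝ)).div_const 4)).add
    ((Real.hasSum_poisson_pow (r : ℝ) (-1)).div_const 4) using 1
  · ext k
    rw [cast_div_two_eq]
    ring
  · ring_nf

theorem integral_even_poissonMeasure :
    ∫ k, (if Even k then (1 : ℝ) else 0) ∂(poissonMeasure r) = (1 + Real.exp (-2 * r)) / 2 := by
  refine integral_poissonMeasure_eq_of_hasSum ?_
  convert! ((Real.hasSum_poisson_one (r : ℝ)).div_const 2).add
    ((Real.hasSum_poisson_pow (r : ℝ) (-1)).div_const 2) using 1
  · ext k
    rw [ite_even_eq]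
    ring
  · ring_nf

theorem variance_div_two_poissonMeasure_le :
    Var[fun k : ℕ => ((k / 2 : ℕ) : ℝ); poissonMeasure r] ≤ (1 + (r : ℝ)) ^ 2 := by
  refine (variance_le_expectation_sq (by fun_prop)).trans ?_
  have h : ∫ k : ℕ, (k : ℝ) ^ 2 ∂(poissonMeasure r) = (r : ℝ) ^ 2 + r :=
    integral_poissonMeasure_eq_of_hasSum (Real.hasSum_poisson_sq _)
  have hle : ∫ k : ℕ, ((fun k : ℕ => ((k / 2 : ℕ) : ℝ)) ^ 2) k ∂(poissonMeasure r)
      ≤ ∫ k : ℕ, (k : ℝ) ^ 2 ∂(poissonMeasure r) := by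
    refine integral_mono_of_nonneg (ae_of_all _ fun k => by simp)
      integrable_sq_poissonMeasure (ae_of_all _ fun k => ?_)
    have : ((k / 2 : ℕ) : ℝ) ≤ k := by exact_mod_cast Nat.div_le_self k 2
    simp only [Pi.pow_apply]
    gcongr
  rw [h] at hle
  have := r.coe_nonneg
  linarith [sq_nonneg (r : ℝ)]

end Poisson

section Concentration

open ProbabilityTheory

/-- Chebyshev's inequality for a sum of pairwise independent variables with common mean. -/
theorem measure_sum_sub_mean_ge_le {Ω ι : Type*} [MeasurableSpace Ω] {μ : Measure Ω}
    [IsProbabilityMeasure μ] {Z : ι → Ω → ℝ} {s : Finset ι} {a v t : ℝ} {N : ℕ}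
    (hZ : ∀ i ∈ s, MemLp (Z i) 2 μ) (hmean : ∀ i ∈ s, ∫ ω, Z i ω ∂μ = a)
    (hvar : ∀ i ∈ s, Var[Z i; μ] ≤ v) (hv : 0 ≤ v)
    (hind : Set.Pairwise (s : Set ι) fun i j => IndepFun (Z i) (Z j) μ)
    (hs : s.card ≤ N) (hN : 0 < N) (ht : 0 < t) :
    μ {ω | t * N ≤ |∑ i ∈ s, Z i ω - a * s.card|} ≤ ENNReal.ofReal (v / (t ^ 2 * N)) := by
  have hN' : (0 : ℝ) < N := by exact_mod_cast hN
  have hm : ∫ ω, (∑ i ∈ s, Z i) ω ∂μ = a * s.card := by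
    simp only [Finset.sum_apply]
    rw [integral_finsetSum _ fun i hi => (hZ i hi).integrable one_le_two,
      Finset.sum_congr rfl hmean]
    simp [mul_comm]
  have h := meas_ge_le_variance_div_sq (memLp_finsetSum' s hZ) (mul_pos ht hN')
  rw [hm] at h
  simp only [Finset.sum_apply] at h
  refine h.trans (ENNReal.ofReal_le_ofReal ?_)
  rw [IndepFun.variance_sum hZ hind]
  have h1 : ∑ i ∈ s, Var[Z i; μ] ≤ N * v := by
    calc ∑ i ∈ s, Var[Z i; μ] ≤ ∑ i ∈ s, v := Finset.sum_le_sum hvar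
      _ = s.card * v := by simp
      _ ≤ N * v := by gcongr
  calc (∑ i ∈ s, Var[Z i; μ]) / (t * N) ^ 2 ≤ (N * v) / (t * N) ^ 2 := by gcongr
    _ = v / (t ^ 2 * N) := by field_simp

variable {n : ℕ} {r : NNReal}

theorem measure_sum_div_two_ge_le {t : ℝ} (ht : 0 < t) :
    (Measure.pi fun _ : ZMod (n + 1) => poissonMeasure r)
      {η | t * (n + 1 : ℕ) ≤ |((∑ x, η x / 2 : ℕ) : ℝ)
        - (r / 2 - 1 / 4 + Real.exp (-2 * r) / 4) * (n + 1 : ℕ)|} ≤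
      ENNReal.ofReal ((1 + r) ^ 2 / (t ^ 2 * (n + 1 : ℕ))) := by
  let μ := Measure.pi fun _ : ZMod (n + 1) => poissonMeasure r
  have hmp := fun x => measurePreserving_eval (fun _ : ZMod (n + 1) => poissonMeasure r) x
  have h := measure_sum_sub_mean_ge_le (μ := μ) (s := Finset.univ)
    (Z := fun (x : ZMod (n + 1)) η => ((η x / 2 : ℕ) : ℝ))
    (a := r / 2 - 1 / 4 + Real.exp (-2 * r) / 4) (v := (1 + r) ^ 2) (t := t) (N := n + 1)
    (fun x _ => memLp_div_two_poissonMeasure.comp_measurePreserving (hmp x))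
    (fun x _ => by
      rw [← integral_div_two_poissonMeasure, ← (hmp x).map_eq, integral_map]
      · exact (hmp x).measurable.aemeasurable
      · exact Measurable.aestronglyMeasurable (by fun_prop))
    (fun x _ => by
      refine le_trans (le_of_eq ?_) variance_div_two_poissonMeasure_le
      conv_rhs => rw [← (hmp x).map_eq]
      rw [variance_map]
      · rfl
      · exact Measurable.aemeasurable (by fun_prop)
      · exact (hmp x).measurable.aemeasurable)
    (by positivity)
    (fun x _ y _ hxy => (iIndepFun_pi (μ := fun _ : ZMod (n + 1) => poissonMeasure r)
      (X := fun _ k => ((k / 2 : ℕ) : ℝ))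
      (fun _ => Measurable.aemeasurable (by fun_prop))).indepFun hxy)
    (by simp [ZMod.card]) (by omega) ht
  simpa [ZMod.card, μ] using h

open Classical in
theorem measure_evenPairs_ge_le (hn : 4 ≤ n) (ζ : ZMod (n + 1) → Label) {t : ℝ} (ht : 0 < t) :
    (Measure.pi fun _ : ZMod (n + 1) => poissonMeasure r)
      {η | t * (n + 1 : ℕ) ≤ |(evenPairs ζ η : ℝ)
        - ((1 + Real.exp (-2 * r)) / 2) ^ 2 * (Finset.univ.filter (IsIsolated ζ)).card|} ≤
      ENNReal.ofReal (1 / (t ^ 2 * (n + 1 : ℕ))) := by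
  let μ := Measure.pi fun _ : ZMod (n + 1) => poissonMeasure r
  have hmp := fun x => measurePreserving_eval (fun _ : ZMod (n + 1) => poissonMeasure r) x
  let W : ℕ → ℝ := fun k => if Even k then 1 else 0
  have hWm : ∫ k, W k ∂(poissonMeasure r) = (1 + Real.exp (-2 * r)) / 2 :=
    integral_even_poissonMeasure
  have hW1 : ∀ k, ‖W k‖ ≤ 1 := fun k => by simp only [W]; split_ifs <;> simp
  let Z : ZMod (n + 1) → (ZMod (n + 1) → ℕ) → ℝ := fun x η => W (η (x - 1)) * W (η (x + 1))
  have hZm : ∀ x, Measurable (Z x) := fun x => by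
    have : Measurable W := measurable_of_countable _
    simp only [Z]
    fun_prop
  have hZ1 : ∀ x η, ‖Z x η‖ ≤ 1 := fun x η => by
    simp only [Z, norm_mul]
    exact mul_le_one₀ (hW1 _) (norm_nonneg _) (hW1 _)
  have hind := iIndepFun_pi (μ := fun _ : ZMod (n + 1) => poissonMeasure r)
      (X := fun _ k => W k) (fun _ => Measurable.aemeasurable (measurable_of_countable _))
  obtain ⟨-, n2⟩ := ZMod.one_ne_zero_and_two_ne_zero hn
  have hint : ∀ x : ZMod (n + 1), ∫ η, W (η x) ∂μ = (1 + Real.exp (-2 * r)) / 2 := fun x => by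
    rw [← hWm, ← (hmp x).map_eq, integral_map]
    · exact (hmp x).measurable.aemeasurable
    · exact Measurable.aestronglyMeasurable (measurable_of_countable _)
  have h := measure_sum_sub_mean_ge_le (μ := μ) (s := Finset.univ.filter (IsIsolated ζ))
    (Z := Z) (a := ((1 + Real.exp (-2 * r)) / 2) ^ 2) (v := 1) (t := t) (N := n + 1)
    (fun x _ => MemLp.of_bound (hZm x).aestronglyMeasurable 1 (ae_of_all _ (hZ1 x)))
    (fun x _ => by
      have hne : x - 1 ≠ x + 1 := fun h => n2 (by linear_combination -h)
      have := (hind.indepFun hne).integral_fun_mul_eq_mul_integral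
        (Measurable.aestronglyMeasurable (measurable_of_countable _))
        (Measurable.aestronglyMeasurable (measurable_of_countable _))
      rw [show ∫ η, Z x η ∂μ = _ from this, hint, hint, sq])
    (fun x _ => by
      refine (variance_le_expectation_sq (hZm x).aestronglyMeasurable).trans ?_
      calc ∫ η, (Z x ^ 2) η ∂μ ≤ ∫ η, 1 ∂μ := by
            refine integral_mono_of_nonneg (ae_of_all _ fun η => by simp; positivity)
              (integrable_const 1) (ae_of_all _ fun η => ?_)
            have := hZ1 x η
            simp only [Pi.pow_apply]
            rw [Real.norm_eq_abs, ← sq_le_one_iff_abs_le_one] at this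
            exact this
        _ = 1 := by simp)
    zero_le_one
    (fun x hx y hy hxy => by
      simp only [Finset.coe_filter, Finset.mem_univ, true_and, Set.mem_ofPred_eq] at hx hy
      have e1 : x - 1 ≠ y + 1 := fun h => by
        have := hy.2.2.1
        rw [show y + 2 = x by linear_combination -h, hx.1] at this
        cases this
      have e2 : x + 1 ≠ y - 1 := fun h => by
        have := hx.2.2.1
        rw [show x + 2 = y by linear_combination h, hy.1] at this
        cases this
      have := hind.indepFun_prodMk_prodMk₀
        (fun i => Measurable.aemeasurable (measurable_of_countable _))
        (x - 1) (x + 1) (y - 1) (y + 1)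
        (fun h => hxy (by linear_combination h)) e1 e2 (fun h => hxy (by linear_combination h))
      exact this.comp (φ := fun p => p.1 * p.2) (ψ := fun p => p.1 * p.2)
        (by fun_prop) (by fun_prop))
    ((Finset.card_filter_le _ _).trans (by simp [ZMod.card])) (by omega) ht
  have hZeq : ∀ η, ∑ x ∈ Finset.univ.filter (IsIsolated ζ), Z x η = evenPairs ζ η := fun η => by
    unfold evenPairs
    push_cast
    rw [Finset.sum_filter]
    refine Finset.sum_congr rfl fun x _ => ?_
    by_cases h0 : IsIsolated ζ x <;> by_cases h1 : Even (η (x - 1)) <;>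
      by_cases h2 : Even (η (x + 1)) <;> simp [Z, W, h0, h1, h2]
  simpa only [hZeq] using h

end Concentration

section Ergodic

/-- The mean ergodic theorem, as convergence in measure of Birkhoff averages to the mean. -/
theorem Ergodic.tendstoInMeasure_birkhoffAverage {Ω : Type*} [MeasurableSpace Ω]
    {μ : Measure Ω} [IsProbabilityMeasure μ] {T : Ω → Ω} (hT : Ergodic T μ) {g : Ω → ℝ}
    (hg : MemLp g 2 μ) :
    TendstoInMeasure μ (fun N => birkhoffAverage ℝ T g N) atTop (fun _ => ∫ ω, g ω ∂μ) := by
  have hmp := hT.toMeasurePreserving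
  let U : Lp ℝ 2 μ →L[ℝ] Lp ℝ 2 μ :=
    (Lp.compMeasurePreservingₗᵢ ℝ T hmp).toContinuousLinearMap
  have hU : ‖U‖ ≤ 1 := LinearIsometry.norm_toContinuousLinearMap_le _
  let G : Lp ℝ 2 μ := hg.toLp g
  let K := U.eqLocus (1 : Lp ℝ 2 μ →L[ℝ] Lp ℝ 2 μ)
  have hlim := U.tendsto_birkhoffAverage_orthogonalProjection hU G
  set y : Lp ℝ 2 μ := ((K.orthogonalProjectionOnto G : K) : Lp ℝ 2 μ) with hy
  have hUapp : ∀ f : Lp ℝ 2 μ, U f =ᵐ[μ] f ∘ T := fun f => Lp.coeFn_compMeasurePreserving f hmp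
  -- the limit is almost surely constant
  have hyfix : U y = y := by
    exact LinearMap.mem_eqLocus.1 (K.orthogonalProjectionOnto G).2
  obtain ⟨c, hc⟩ := hT.ae_eq_const_of_ae_eq_comp_ae (Lp.aestronglyMeasurable y)
    ((hUapp y).symm.trans (by rw [hyfix]))
  -- the constant is the mean
  let one : Lp ℝ 2 μ := indicatorConstLp 2 MeasurableSet.univ (measure_ne_top μ _) (1 : ℝ)
  have hone : one ∈ K := by
    change U one = one
    refine Lp.ext ((hUapp one).trans ?_)
    have h1 : one =ᵐ[μ] fun _ => (1 : ℝ) := by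
      have h2 := indicatorConstLp_coeFn (p := 2) (hs := MeasurableSet.univ)
        (hμs := measure_ne_top μ _) (c := (1 : ℝ))
      rwa [Set.indicator_univ] at h2
    exact (hmp.quasiMeasurePreserving.ae_eq_comp h1).trans h1.symm
  have hmean : c = ∫ ω, g ω ∂μ := by
    have h0 : inner ℝ one (G - y) = 0 := by
      rw [real_inner_comm]
      exact Submodule.starProjection_inner_eq_zero G one hone
    rw [inner_sub_right, L2.inner_indicatorConstLp_one, L2.inner_indicatorConstLp_one,
      Measure.restrict_univ, integral_congr_ae hc, integral_congr_ae hg.coeFn_toLp] at h0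
    simp at h0
    linarith
  -- identification of the averages in `L²`
  have hiter : ∀ k, (U^[k]) G =ᵐ[μ] g ∘ T^[k] := by
    intro k
    induction k with
    | zero => simpa using hg.coeFn_toLp
    | succ k ih =>
      rw [Function.iterate_succ_apply', Function.iterate_succ]
      exact (hUapp _).trans (hmp.quasiMeasurePreserving.ae_eq_comp ih)
  have havg : ∀ N, (birkhoffAverage ℝ U _root_.id N G : Lp ℝ 2 μ) =ᵐ[μ]
      birkhoffAverage ℝ T g N := by
    intro N
    have hsum : (birkhoffSum U _root_.id N G : Lp ℝ 2 μ) =ᵐ[μ] birkhoffSum T g N := by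
      have h := (Lp.coeFn_finsetSum (Finset.range N) fun k => (U^[k]) G)
      have h2 : ∀ᵐ ω ∂μ, ∀ k, (U^[k]) G ω = (g ∘ T^[k]) ω := ae_all_iff.2 hiter
      filter_upwards [h, h2] with ω h h2
      simp only [birkhoffSum, _root_.id]
      rw [h, Finset.sum_apply]
      exact Finset.sum_congr rfl fun k _ => h2 k
    filter_upwards [Lp.coeFn_smul ((N : ℝ)⁻¹) (birkhoffSum U _root_.id N G), hsum]
      with ω h1 h2
    simp only [birkhoffAverage]
    rw [h1, Pi.smul_apply, h2]
  refine (tendstoInMeasure_of_tendsto_Lp hlim).congr havg ?_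
  rw [← hmean]
  exact hc

theorem measurableSet_label_zero_eq_s : MeasurableSet {ζ : ℤ → Label | ζ 0 = Label.s} :=
  measurable_pi_apply (X := fun _ : ℤ => Label) 0 (show MeasurableSet {Label.s} from trivial)

/-- For an ergodic shift, the number of `s`-labels in `{0, …, n}` concentrates. -/
theorem tendsto_measure_count_label {ν : Measure (ℤ → Label)} [IsProbabilityMeasure ν]
    (hshift : Ergodic (fun ζ : ℤ → Label => fun x => ζ (x + 1)) ν) {δ : ℝ} (hδ : 0 < δ) :
    Tendsto (fun n : ℕ => ν {ζ | δ * (n + 1 : ℕ) ≤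
      |((∑ k ∈ Finset.range (n + 1), if ζ k = Label.s then 1 else 0 : ℕ) : ℝ)
        - (ν {ζ | ζ 0 = Label.s}).toReal * (n + 1 : ℕ)|}) atTop (𝓝 0) := by
  let g : (ℤ → Label) → ℝ := Set.indicator {ζ | ζ 0 = Label.s} fun _ => 1
  have hg : MemLp g 2 ν :=
    memLp_indicator_const 2 measurableSet_label_zero_eq_s 1 (.inr (measure_ne_top _ _))
  have hmean : ∫ ζ, g ζ ∂ν = (ν {ζ | ζ 0 = Label.s}).toReal := by
    simp [g, integral_indicator_const _ measurableSet_label_zero_eq_s, Measure.real]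
  have h := (tendstoInMeasure_iff_norm.1 (hshift.tendstoInMeasure_birkhoffAverage hg) δ hδ).comp
    (tendsto_add_atTop_nat 1)
  refine h.congr fun n => ?_
  simp only [Function.comp_apply, hmean]
  congr 1
  ext ζ
  have hiter : ∀ k : ℕ, (fun ζ : ℤ → Label => fun x => ζ (x + 1))^[k] ζ = fun x => ζ (x + k) := by
    intro k
    induction k with
    | zero => simp
    | succ k ih =>
      rw [Function.iterate_succ_apply', ih]
      funext x
      push_cast
      congr 1
      ring
  have hn : (0 : ℝ) < (n + 1 : ℕ) := by positivity
  have hsum : birkhoffAverage ℝ (fun ζ : ℤ → Label => fun x => ζ (x + 1)) g (n + 1) ζ =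
      ((n + 1 : ℕ) : ℝ)⁻¹ *
        ((∑ k ∈ Finset.range (n + 1), if ζ k = Label.s then 1 else 0 : ℕ) : ℝ) := by
    simp only [birkhoffAverage, birkhoffSum, smul_eq_mul]
    congr 1
    push_cast
    refine Finset.sum_congr rfl fun k _ => ?_
    rw [hiter]
    simp [g, Set.indicator_apply]
  rw [Set.mem_ofPred_eq, Set.mem_ofPred_eq, hsum, Real.norm_eq_abs]
  rw [← mul_le_mul_iff_left₀ hn]
  generalize ((∑ k ∈ Finset.range (n + 1), if ζ k = Label.s then 1 else 0 : ℕ) : ℝ) = S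
  generalize (ν {ζ | ζ 0 = Label.s}).toReal = f
  generalize ((n + 1 : ℕ) : ℝ) = N at hn ⊢
  have habs : |N⁻¹ * S - f| * N = |S - f * N| := by
    rw [show S - f * N = (N⁻¹ * S - f) * N by field_simp, abs_mul, abs_of_pos hn]
  rw [habs]

end Ergodic

section Restriction

variable {n : ℕ}

/-- No two `s`-labels lie within distance two of each other. -/
def IsSparse (ζ : ℤ → Label) : Prop :=
  ∀ x : ℤ, ¬(ζ x = Label.s ∧ ζ (x + 1) = Label.s) ∧ ¬(ζ x = Label.s ∧ ζ (x + 2) = Label.s)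

/-- The labels on the cycle obtained by restricting `ζ` to `{0, …, n}`. -/
def cycRestrict (n : ℕ) (ζ : ℤ → Label) (x : ZMod (n + 1)) : Label := ζ (x.val : ℤ)

theorem measurable_cycRestrict : Measurable (cycRestrict n) :=
  measurable_pi_lambda _ fun x => measurable_pi_apply (X := fun _ : ℤ => Label) (x.val : ℤ)

theorem cycRestrict_natCast {k : ℕ} (hk : k ≤ n) (ζ : ℤ → Label) :
    cycRestrict n ζ (k : ZMod (n + 1)) = ζ k := by
  rw [cycRestrict, ZMod.val_cast_of_lt (by omega)]

theorem IsSparse.eq_r {ζ : ℤ → Label} (h : IsSparse ζ) {x y : ℤ} (hx : ζ x = Label.s)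
    (hne : x ≠ y) (hle : |x - y| ≤ 2) : ζ y = Label.r := by
  refine (Label.eq_r_or_eq_s _).resolve_right fun hy => ?_
  rw [abs_le] at hle
  obtain rfl | rfl | rfl | rfl : y = x + 1 ∨ y = x + 2 ∨ x = y + 1 ∨ x = y + 2 := by omega
  · exact (h x).1 ⟨hx, hy⟩
  · exact (h x).2 ⟨hx, hy⟩
  · exact (h y).1 ⟨hy, hx⟩
  · exact (h y).2 ⟨hy, hx⟩

theorem ZMod.exists_natCast_eq (x : ZMod (n + 1)) : ∃ k ≤ n, (k : ZMod (n + 1)) = x :=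
  ⟨x.val, Nat.lt_succ_iff.1 (ZMod.val_lt x), ZMod.natCast_zmod_val x⟩

theorem IsSparse.cycRestrict_add_two (hn : 4 ≤ n) {ζ : ℤ → Label} (h : IsSparse ζ)
    (x : ZMod (n + 1)) (h0 : cycRestrict n ζ x = Label.s)
    (h1 : cycRestrict n ζ (x + 1) = Label.s) : cycRestrict n ζ (x + 2) = Label.r := by
  obtain ⟨k, hk, rfl⟩ := ZMod.exists_natCast_eq x
  have hself : ((n : ℕ) : ZMod (n + 1)) + 1 = 0 := by exact_mod_cast ZMod.natCast_self (n + 1)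
  obtain hk | rfl := hk.lt_or_eq
  · rw [cycRestrict_natCast hk.le] at h0
    have := cycRestrict_natCast (k := k + 1) hk ζ
    push_cast at this
    rw [this] at h1
    exact absurd ⟨h0, h1⟩ (h k).1
  · rw [hself] at h1
    rw [show (k : ZMod (k + 1)) + 2 = ((1 : ℕ) : ZMod (k + 1)) by
      push_cast; linear_combination hself, cycRestrict_natCast (by omega)]
    have h2 := cycRestrict_natCast (n := k) (k := 0) (by omega) ζ
    push_cast at h2
    rw [h2] at h1
    exact h.eq_r h1 (by norm_num) (by norm_num)

theorem IsSparse.isIsolated_cycRestrict {ζ : ℤ → Label} (h : IsSparse ζ) {k : ℕ}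
    (h2 : 2 ≤ k) (hkn : k + 2 ≤ n) (hk : ζ k = Label.s) :
    IsIsolated (cycRestrict n ζ) (k : ZMod (n + 1)) := by
  have hval : ∀ (j : ℕ) (x : ZMod (n + 1)), j ≤ n → (j : ZMod (n + 1)) = x → j ≠ k →
      |(k : ℤ) - j| ≤ 2 → cycRestrict n ζ x = Label.r := by
    rintro j x hj rfl hne hle
    rw [cycRestrict_natCast hj]
    exact h.eq_r hk (by omega) hle
  obtain ⟨m, rfl⟩ := Nat.exists_eq_add_of_le' h2
  refine ⟨by rwa [cycRestrict_natCast (by omega)], hval (m + 3) _ (by omega) ?_ (by omega) ?_,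
    hval (m + 4) _ (by omega) ?_ (by omega) ?_, hval (m + 1) _ (by omega) ?_ (by omega) ?_,
    hval m _ (by omega) ?_ (by omega) ?_⟩
  all_goals first | (push_cast; ring1) | (rw [abs_le]; push_cast; constructor <;> linarith)

open Classical in
theorem IsSparse.defects_cycRestrict_le {ζ : ℤ → Label} (h : IsSparse ζ) :
    defects (cycRestrict n ζ) ≤ 4 := by
  rw [defects, ← Finset.card_filter]
  refine (Finset.card_le_card (t := ({0, 1, n - 1, n} : Finset ℕ).image
    (Nat.cast : ℕ → ZMod (n + 1))) fun x hx => ?_).trans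
    (Finset.card_image_le.trans Finset.card_le_four)
  obtain ⟨k, hk, rfl⟩ := ZMod.exists_natCast_eq x
  rw [Finset.mem_filter, cycRestrict_natCast hk] at hx
  refine Finset.mem_image_of_mem _ ?_
  have : ¬(2 ≤ k ∧ k + 2 ≤ n) := fun hc => hx.2.2 (h.isIsolated_cycRestrict hc.1 hc.2 hx.2.1)
  simp only [Finset.mem_insert, Finset.mem_singleton]
  omega

open Classical in
theorem card_isIsolated_add_defects (ζ : ℤ → Label) :
    (Finset.univ.filter (IsIsolated (cycRestrict n ζ))).card + defects (cycRestrict n ζ) =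
      ∑ k ∈ Finset.range (n + 1), if ζ k = Label.s then 1 else 0 := by
  rw [defects, Finset.card_filter, ← Finset.sum_add_distrib]
  refine Finset.sum_nbij' ZMod.val (fun j : ℕ => (j : ZMod (n + 1)))
    (fun x _ => by simpa using ZMod.val_lt x) (by simp) (by simp)
    (fun j hj => ZMod.val_cast_of_lt (by simpa using hj)) fun x _ => ?_
  change _ = if cycRestrict n ζ x = Label.s then 1 else 0
  by_cases h1 : IsIsolated (cycRestrict n ζ) x
  · simp [h1, h1.1]
  · simp [h1]

end Restriction

section Excess

/-- Mean number of available pairs of particles per site minus the mean number of pairs that the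
isolated `s`-sites can absorb, at particle density `ρ` and with density `f` of `s`-labels. -/
noncomputable def excess (f ρ : ℝ) : ℝ :=
  ρ / 2 - 1 / 4 + Real.exp (-2 * ρ) / 4 - ((1 + Real.exp (-2 * ρ)) / 2) ^ 2 * f

variable {f ρ : ℝ}

theorem excess_eq_zero_iff : excess f ρ = 0 ↔
    ρ - (1 / 2) * (1 - Real.exp (-2 * ρ)) = (f / 2) * (1 + Real.exp (-2 * ρ)) ^ 2 := by
  rw [excess]
  exact ⟨fun h => by linear_combination 2 * h, fun h => by linear_combination h / 2⟩

theorem excess_strictMonoOn (hf : 0 ≤ f) : StrictMonoOn (excess f) (Set.Ici 0) := by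
  intro a ha b _ hab
  have ha : 0 ≤ a := ha
  have hq : Real.exp (-2 * b) ≤ Real.exp (-2 * a) := Real.exp_le_exp.2 (by linarith)
  have hsq : ((1 + Real.exp (-2 * b)) / 2) ^ 2 * f ≤ ((1 + Real.exp (-2 * a)) / 2) ^ 2 * f := by
    have := Real.exp_pos (-2 * b)
    gcongr
  have h1 : Real.exp (-2 * a) ≤ 1 := Real.exp_le_one_iff.2 (by linarith)
  have h2 : -2 * (b - a) + 1 < Real.exp (-2 * (b - a)) := Real.add_one_lt_exp (by linarith)
  have h3 : Real.exp (-2 * b) = Real.exp (-2 * a) * Real.exp (-2 * (b - a)) := by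
    rw [← Real.exp_add]
    ring_nf
  have h4 : Real.exp (-2 * (b - a)) ≤ 1 := Real.exp_le_one_iff.2 (by linarith)
  have h5 : Real.exp (-2 * a) - Real.exp (-2 * b) ≤ 1 - Real.exp (-2 * (b - a)) := by
    rw [h3]
    nlinarith
  rw [excess, excess]
  linarith

theorem half_exp_sq_le_one (hρ : 0 ≤ ρ) : ((1 + Real.exp (-2 * ρ)) / 2) ^ 2 ≤ 1 := by
  have h1 : Real.exp (-2 * ρ) ≤ 1 := Real.exp_le_one_iff.2 (by linarith)
  have := Real.exp_pos (-2 * ρ)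
  exact pow_le_one₀ (by linarith) (by linarith)

theorem le_excess (hf : 0 ≤ f) (hf1 : f ≤ 1) (hρ : 0 ≤ ρ) : ρ / 2 - 5 / 4 ≤ excess f ρ := by
  have h := mul_le_mul (half_exp_sq_le_one hρ) hf1 hf zero_le_one
  have := Real.exp_pos (-2 * ρ)
  rw [excess]
  linarith

theorem exists_excess_eq_zero (hf : 0 < f) (hf1 : f ≤ 1) : ∃ ρ, 0 < ρ ∧ excess f ρ = 0 := by
  have hcont : ContinuousOn (excess f) (Set.Icc 0 4) := by
    unfold excess
    fun_prop
  have h0 : excess f 0 = -f := by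
    rw [excess]
    norm_num
  have h4 := le_excess hf.le hf1 (ρ := 4) (by norm_num)
  obtain ⟨ρ, hρ, h⟩ := intermediate_value_Icc (by norm_num) hcont
    (show (0 : ℝ) ∈ Set.Icc (excess f 0) (excess f 4) from ⟨by linarith, by linarith⟩)
  refine ⟨ρ, lt_of_le_of_ne hρ.1 ?_, h⟩
  rintro rfl
  linarith

theorem exists_mul_le_excess (hf : 0 ≤ f) (hf1 : f ≤ 1) {a : ℝ} (ha : 0 ≤ a)
    (hpos : 0 < excess f a) : ∃ c > 0, ∀ ρ ≥ a, c * (1 + ρ) ≤ excess f ρ := by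
  refine ⟨min (excess f a / 5) (1 / 10), by positivity, fun ρ hρ => ?_⟩
  have hρ0 : 0 ≤ 1 + ρ := by linarith
  obtain h | h := le_total ρ 4
  · calc min (excess f a / 5) (1 / 10) * (1 + ρ) ≤ excess f a / 5 * 5 := by
          gcongr
          · exact min_le_left _ _
          · linarith
      _ = excess f a := by ring
      _ ≤ excess f ρ := (excess_strictMonoOn hf).monotoneOn ha (ha.trans hρ) hρ
  · calc min (excess f a / 5) (1 / 10) * (1 + ρ) ≤ 1 / 10 * (1 + ρ) := by
          gcongr
          exact min_le_right _ _
      _ ≤ ρ / 2 - 5 / 4 := by linarith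
      _ ≤ excess f ρ := le_excess hf hf1 (by linarith)

end Excess

section Threshold

open ProbabilityTheory

/-- The law of a Poisson configuration of heights and of the restriction to the cycle of a
`ν`-sample. -/
noncomputable def quenchedLaw (ν : Measure (ℤ → Label)) (r : NNReal) (n : ℕ) :
    Measure ((ZMod (n + 1) → ℕ) × (ZMod (n + 1) → Label)) :=
  (Measure.pi fun _ => poissonMeasure r).prod (ν.map (cycRestrict n))

/-- The labellings whose number of `s`-labels in `{0, …, n}` differs from `f * (n + 1)` by at least
`δ * (n + 1)`. -/
def atypicalCount (f δ : ℝ) (n : ℕ) : Set (ℤ → Label) :=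
  {ζ | δ * (n + 1 : ℕ) ≤
    |((∑ k ∈ Finset.range (n + 1), if ζ k = Label.s then 1 else 0 : ℕ) : ℝ) - f * (n + 1 : ℕ)|}

instance (ν : Measure (ℤ → Label)) [IsProbabilityMeasure ν] (n : ℕ) :
    IsProbabilityMeasure (ν.map (cycRestrict n)) :=
  Measure.isProbabilityMeasure_map measurable_cycRestrict.aemeasurable

instance (ν : Measure (ℤ → Label)) [IsProbabilityMeasure ν] (r : NNReal) (n : ℕ) :
    IsProbabilityMeasure (quenchedLaw ν r n) := by
  unfold quenchedLaw
  infer_instance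

instance : Finite Label :=
  Finite.of_injective (fun l => decide (l = Label.s)) fun a b h => by
    cases a <;> cases b <;> simp_all

theorem measurableSet_height_label {n : ℕ}
    (A : Set ((ZMod (n + 1) → ℕ) × (ZMod (n + 1) → Label))) : MeasurableSet A :=
  A.to_countable.measurableSet

open Classical in
/-- Off a set of small probability, the number of pairs of particles, the number of isolated
`s`-sites with even neighbors and the number of `s`-labels are all close to their means. -/
theorem quenchedLaw_le {ν : Measure (ℤ → Label)} [IsProbabilityMeasure ν]
    (hsparse : ∀ᵐ ζ ∂ν, IsSparse ζ) {n : ℕ} (hn : 4 ≤ n) (r : NNReal) {f δ t₁ t₂ : ℝ}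
    (ht₁ : 0 < t₁) (ht₂ : 0 < t₂) {A : Set ((ZMod (n + 1) → ℕ) × (ZMod (n + 1) → Label))}
    (hA : ∀ ζ, IsSparse ζ → ζ ∉ atypicalCount f δ n → ∀ η,
      |((∑ x, η x / 2 : ℕ) : ℝ)
        - (r / 2 - 1 / 4 + Real.exp (-2 * r) / 4) * (n + 1 : ℕ)| < t₁ * (n + 1 : ℕ) →
      |(evenPairs (cycRestrict n ζ) η : ℝ) - ((1 + Real.exp (-2 * r)) / 2) ^ 2 *
        (Finset.univ.filter (IsIsolated (cycRestrict n ζ))).card| < t₂ * (n + 1 : ℕ) →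
      (η, cycRestrict n ζ) ∉ A) :
    quenchedLaw ν r n A ≤ ENNReal.ofReal ((1 + r) ^ 2 / (t₁ ^ 2 * (n + 1 : ℕ))) +
      ENNReal.ofReal (1 / (t₂ ^ 2 * (n + 1 : ℕ))) + ν (atypicalCount f δ n) := by
  set E₁ : Set (ZMod (n + 1) → ℕ) := {η | t₁ * (n + 1 : ℕ) ≤ |((∑ x, η x / 2 : ℕ) : ℝ)
    - (r / 2 - 1 / 4 + Real.exp (-2 * r) / 4) * (n + 1 : ℕ)|} with hE₁
  set E₂ : Set ((ZMod (n + 1) → ℕ) × (ZMod (n + 1) → Label)) :=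
    {p | t₂ * (n + 1 : ℕ) ≤ |(evenPairs p.2 p.1 : ℝ) - ((1 + Real.exp (-2 * r)) / 2) ^ 2 *
      (Finset.univ.filter (IsIsolated p.2)).card|} with hE₂
  set B : Set (ZMod (n + 1) → Label) :=
    (cycRestrict n '' {ζ | IsSparse ζ ∧ ζ ∉ atypicalCount f δ n})ᶜ with hB
  have hsub : A ⊆ (E₁ ×ˢ Set.univ) ∪ E₂ ∪ (Set.univ ×ˢ B) := by
    rintro ⟨η, ζ'⟩ hp
    by_contra hc
    simp only [Set.mem_union, Set.mem_prod, Set.mem_univ, and_true, true_and, not_or, hB,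
      Set.mem_compl_iff, not_not] at hc
    obtain ⟨⟨h1, h2⟩, ζ, ⟨hs, hcount⟩, rfl⟩ := hc
    exact hA ζ hs hcount η (not_le.1 h1) (not_le.1 h2) hp
  have h1 : quenchedLaw ν r n (E₁ ×ˢ Set.univ) ≤
      ENNReal.ofReal ((1 + r) ^ 2 / (t₁ ^ 2 * (n + 1 : ℕ))) := by
    rw [quenchedLaw, Measure.prod_prod, measure_univ, mul_one]
    exact measure_sum_div_two_ge_le ht₁
  have h2 : quenchedLaw ν r n E₂ ≤ ENNReal.ofReal (1 / (t₂ ^ 2 * (n + 1 : ℕ))) := by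
    rw [quenchedLaw, Measure.prod_apply_symm (measurableSet_height_label _)]
    refine (lintegral_mono (g := fun _ => ENNReal.ofReal (1 / (t₂ ^ 2 * (n + 1 : ℕ))))
      fun ζ => measure_evenPairs_ge_le hn ζ ht₂).trans ?_
    simp
  have h3 : quenchedLaw ν r n (Set.univ ×ˢ B) ≤ ν (atypicalCount f δ n) := by
    rw [quenchedLaw, Measure.prod_prod, measure_univ, one_mul,
      Measure.map_apply measurable_cycRestrict B.to_countable.measurableSet]
    refine measure_mono_ae ?_
    filter_upwards [hsparse] with ζ hζ hmem
    by_contra hc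
    exact hmem ⟨ζ, ⟨hζ, hc⟩, rfl⟩
  calc quenchedLaw ν r n A ≤ _ := measure_mono hsub
    _ ≤ _ := measure_union_le _ _
    _ ≤ _ := add_le_add ((measure_union_le _ _).trans (add_le_add h1 h2)) h3

open Classical in
theorem IsSparse.card_isIsolated_bounds {ζ : ℤ → Label} (h : IsSparse ζ) {f δ : ℝ} {n : ℕ}
    (hc : ζ ∉ atypicalCount f δ n) :
    (f - δ) * (n + 1 : ℕ) - 4 ≤ (Finset.univ.filter (IsIsolated (cycRestrict n ζ))).card ∧
      (Finset.univ.filter (IsIsolated (cycRestrict n ζ))).card ≤ (f + δ) * (n + 1 : ℕ) := by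
  rw [atypicalCount, Set.mem_ofPred_eq, not_le, ← card_isIsolated_add_defects, abs_lt] at hc
  have h4 : (defects (cycRestrict n ζ) : ℝ) ≤ 4 := by exact_mod_cast h.defects_cycRestrict_le
  push_cast at hc ⊢
  have := Nat.cast_nonneg (α := ℝ) (defects (cycRestrict n ζ))
  constructor <;> linarith

theorem tendsto_error {ν : Measure (ℤ → Label)} [IsProbabilityMeasure ν]
    (hshift : Ergodic (fun ζ : ℤ → Label => fun x => ζ (x + 1)) ν) {δ : ℝ} (hδ : 0 < δ)
    (C₁ C₂ : ℝ) :
    Tendsto (fun n : ℕ => ENNReal.ofReal (C₁ / (n + 1 : ℕ)) + ENNReal.ofReal (C₂ / (n + 1 : ℕ)) +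
      ν (atypicalCount (ν {ζ | ζ 0 = Label.s}).toReal δ n)) atTop (𝓝 0) := by
  have h : ∀ C : ℝ, Tendsto (fun n : ℕ => ENNReal.ofReal (C / (n + 1 : ℕ))) atTop (𝓝 0) := by
    intro C
    rw [← ENNReal.ofReal_zero]
    exact ENNReal.tendsto_ofReal ((tendsto_const_div_atTop_nhds_zero_nat C).comp
      (tendsto_add_atTop_nat 1))
  rw [← add_zero (0 : ENNReal)]
  nth_rw 1 [← add_zero (0 : ENNReal)]
  exact ((h C₁).add (h C₂)).add (tendsto_measure_count_label hshift hδ)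

variable {ν : Measure (ℤ → Label)} [IsProbabilityMeasure ν]

theorem eventually_half_le_stabilizable
    (hshift : Ergodic (fun ζ : ℤ → Label => fun x => ζ (x + 1)) ν)
    (hsparse : ∀ᵐ ζ ∂ν, IsSparse ζ) (r : NNReal)
    (hr : excess (ν {ζ | ζ 0 = Label.s}).toReal r < 0) :
    ∀ᶠ n : ℕ in atTop, (1 : ENNReal) / 2 ≤
      quenchedLaw ν r n {p | CycStabilizable n p.1 p.2} := by
  set f := (ν {ζ | ζ 0 = Label.s}).toReal
  set e := -excess f r with he
  have he0 : 0 < e := by linarith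
  have herr := (tendsto_error hshift (δ := e / 4) (by positivity)
    ((1 + r) ^ 2 / (e / 4) ^ 2) (1 / (e / 4) ^ 2)).eventually
      (gt_mem_nhds (show (0 : ENNReal) < 1 / 2 by simp))
  filter_upwards [herr, eventually_ge_atTop 4, eventually_ge_atTop ⌈16 / e⌉₊] with n herr hn hne
  have hN : 16 ≤ e * (n + 1 : ℕ) := by
    have h := (Nat.le_ceil _).trans (Nat.cast_le (α := ℝ).2 hne)
    rw [div_le_iff₀ he0] at h
    push_cast
    nlinarith
  have hcompl : quenchedLaw ν r n {p | CycStabilizable n p.1 p.2}ᶜ < 1 / 2 := by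
    refine (quenchedLaw_le hsparse hn r (f := f) (δ := e / 4) (t₁ := e / 4) (t₂ := e / 4)
      (by positivity) (by positivity) ?_).trans_lt (by simpa only [div_div] using herr)
    intro ζ hζ hc η h1 h2 hmem
    refine hmem (CycStabilizable.of_sum_div_two_le (hζ.cycRestrict_add_two hn) ?_)
    rw [abs_lt] at h1 h2
    have hK := (hζ.card_isIsolated_bounds hc).1
    have hb := half_exp_sq_le_one r.coe_nonneg
    rw [excess] at he
    set b := ((1 + Real.exp (-2 * (r : ℝ))) / 2) ^ 2
    have hb0 : 0 ≤ b := sq_nonneg _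
    have hbK := mul_le_mul_of_nonneg_left hK hb0
    have hbN := mul_le_mul_of_nonneg_right hb
      (show 0 ≤ e / 4 * (n + 1 : ℕ) + 4 by positivity)
    have hcast : ((∑ x, η x / 2 : ℕ) : ℝ) ≤ evenPairs (cycRestrict n ζ) η := by
      have : (r / 2 - 1 / 4 + Real.exp (-2 * r) / 4) * ((n + 1 : ℕ) : ℝ) =
          b * f * (n + 1 : ℕ) - e * (n + 1 : ℕ) := by
        rw [he]
        ring
      linarith [h1.2, h2.1]
    exact_mod_cast hcast
  have h := prob_add_prob_compl (μ := quenchedLaw ν r n)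
    (measurableSet_height_label {p | CycStabilizable n p.1 p.2})
  by_contra! hlt
  have := ENNReal.add_lt_add hlt hcompl
  rw [h, ENNReal.add_halves] at this
  exact lt_irrefl _ this

theorem eventually_forall_stabilizable_lt_half
    (hshift : Ergodic (fun ζ : ℤ → Label => fun x => ζ (x + 1)) ν)
    (hsparse : ∀ᵐ ζ ∂ν, IsSparse ζ) {a : ℝ} (ha : 0 ≤ a)
    (hpos : 0 < excess (ν {ζ | ζ 0 = Label.s}).toReal a) :
    ∀ᶠ n : ℕ in atTop, ∀ r : NNReal, a ≤ r →
      quenchedLaw ν r n {p | CycStabilizable n p.1 p.2} < 1 / 2 := by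
  set f := (ν {ζ | ζ 0 = Label.s}).toReal
  obtain ⟨c, hc0, hc⟩ := exists_mul_le_excess ENNReal.toReal_nonneg measureReal_le_one ha hpos
  have herr := (tendsto_error hshift (δ := c / 4) (by positivity)
    (1 / (c / 4) ^ 2) (1 / (c / 4) ^ 2)).eventually
      (gt_mem_nhds (show (0 : ENNReal) < 1 / 2 by simp))
  filter_upwards [herr, eventually_ge_atTop 4, eventually_ge_atTop ⌈16 / c⌉₊]
    with n herr hn hnc r hr
  have hN : 16 ≤ c * (n + 1 : ℕ) := by
    have h := (Nat.le_ceil _).trans (Nat.cast_le (α := ℝ).2 hnc)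
    rw [div_le_iff₀ hc0] at h
    push_cast
    nlinarith
  have hr1 : (0 : ℝ) < 1 + r := by positivity
  refine (quenchedLaw_le hsparse hn r (f := f) (δ := c / 4) (t₁ := c / 4 * (1 + r))
    (t₂ := c / 4) (by positivity) (by positivity) ?_).trans_lt ?_
  · intro ζ hζ hcount η h1 h2 hmem
    have hle := CycStabilizable.sum_div_two_le hn hmem
    have hle' : ((∑ x, η x / 2 : ℕ) : ℝ) ≤ evenPairs (cycRestrict n ζ) η + 4 := by
      exact_mod_cast hle.trans (Nat.add_le_add_left hζ.defects_cycRestrict_le _)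
    rw [abs_lt] at h1 h2
    have hK := (hζ.card_isIsolated_bounds hcount).2
    have hb := half_exp_sq_le_one r.coe_nonneg
    have hexc := mul_le_mul_of_nonneg_right (hc r hr) (Nat.cast_nonneg (α := ℝ) (n + 1))
    rw [excess] at hexc
    set b := ((1 + Real.exp (-2 * (r : ℝ))) / 2) ^ 2
    have hb0 : 0 ≤ b := sq_nonneg _
    have hbK := mul_le_mul_of_nonneg_left hK hb0
    have hbN := mul_le_mul_of_nonneg_right hb (show 0 ≤ c / 4 * (n + 1 : ℕ) by positivity)
    have hrN : 0 ≤ c * r * (n + 1 : ℕ) := by positivity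
    linarith [h1.1, h2.2]
  · have : (1 + (r : ℝ)) ^ 2 / ((c / 4 * (1 + r)) ^ 2 * (n + 1 : ℕ)) =
        1 / (c / 4) ^ 2 / (n + 1 : ℕ) := by
      field_simp
    rw [this, ← div_div 1]
    exact herr

end Threshold

/-- Theorem 3.1: for a shift-invariant ergodic `ν` on `{r,s}^ℤ`,
almost surely with no two `s`-labels within distance 2 and with `ν(ζ 0 = s) > 0`,
the threshold density `ρ_th = lim_n sup {ρ > 0 | P(Poisson-ρ state on C_n
stabilizable) ≥ 1/2}` exists and equals the unique positive solution of
`ρ - (1/2)(1 - e^{-2ρ}) = ((1 - f_r)/2)(1 + e^{-2ρ})²`, i.e. `ρ_th = ρ_tr`. -/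
theorem threshold_equals_transition
    (ν : Measure (ℤ → Label)) [IsProbabilityMeasure ν]
    (hshift : Ergodic (fun ζ : ℤ → Label => fun x => ζ (x + 1)) ν)
    (hrestr : ∀ᵐ ζ ∂ν, ∀ x : ℤ,
      ¬(ζ x = Label.s ∧ ζ (x + 1) = Label.s) ∧
      ¬(ζ x = Label.s ∧ ζ (x + 2) = Label.s))
    (hs : 0 < ν {ζ | ζ 0 = Label.s})
    (P : ℝ → Measure ℕ)
    (hPprob : ∀ ρ : ℝ, 0 < ρ → IsProbabilityMeasure (P ρ))
    (hP : ∀ ρ : ℝ, 0 < ρ → ∀ k : ℕ,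
      P ρ {k} = ENNReal.ofReal (Real.exp (-ρ) * ρ ^ k / k.factorial))
    (fr : ℝ) (hfr : fr = (ν {ζ | ζ 0 = Label.r}).toReal) :
    ∃ ρstar : ℝ,
      (0 < ρstar ∧
        ρstar - (1 / 2) * (1 - Real.exp (-2 * ρstar))
          = ((1 - fr) / 2) * (1 + Real.exp (-2 * ρstar)) ^ 2) ∧
      (∀ ρ : ℝ, 0 < ρ →
        ρ - (1 / 2) * (1 - Real.exp (-2 * ρ))
          = ((1 - fr) / 2) * (1 + Real.exp (-2 * ρ)) ^ 2 → ρ = ρstar) ∧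
      Tendsto
        (fun n : ℕ => sSup {ρ : ℝ | 0 < ρ ∧
          (1 : ENNReal) / 2 ≤
            ((Measure.pi fun _ : ZMod (n + 1) => P ρ).prod
              (ν.map fun ζ : ℤ → Label => fun x : ZMod (n + 1) => ζ (x.val : ℤ)))
              {p | CycStabilizable n p.1 p.2}})
        atTop (𝓝 ρstar) := by
  have hr : fr = 1 - (ν {ζ | ζ 0 = Label.s}).toReal := by
    have hcompl : {ζ : ℤ → Label | ζ 0 = Label.r} = {ζ | ζ 0 = Label.s}ᶜ := by
      ext ζ
      obtain h | h := (ζ 0).eq_r_or_eq_s <;> simp [h]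
    rw [hfr, hcompl]
    exact probReal_compl_eq_one_sub measurableSet_label_zero_eq_s
  have hf0 : 0 < (ν {ζ | ζ 0 = Label.s}).toReal := ENNReal.toReal_pos hs.ne' (measure_ne_top _ _)
  have hf1 : (ν {ζ | ζ 0 = Label.s}).toReal ≤ 1 := measureReal_le_one
  have hf : 1 - fr = (ν {ζ | ζ 0 = Label.s}).toReal := by rw [hr]; ring
  have hlaw : ∀ n (ρ : ℝ), 0 < ρ → (Measure.pi fun _ : ZMod (n + 1) => P ρ).prod
      (ν.map fun ζ : ℤ → Label => fun x : ZMod (n + 1) => ζ (x.val : ℤ)) =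
        quenchedLaw ν ρ.toNNReal n := by
    intro n ρ hρ
    have hPρ : P ρ = ProbabilityTheory.poissonMeasure ρ.toNNReal := by
      refine Measure.ext_of_singleton fun k => ?_
      rw [hP ρ hρ, ProbabilityTheory.poissonMeasure_singleton, Real.coe_toNNReal ρ hρ.le]
    rw [quenchedLaw, hPρ]
    rfl
  have hset : ∀ n : ℕ, {ρ : ℝ | 0 < ρ ∧ (1 : ENNReal) / 2 ≤
      ((Measure.pi fun _ : ZMod (n + 1) => P ρ).prod
        (ν.map fun ζ : ℤ → Label => fun x : ZMod (n + 1) => ζ (x.val : ℤ)))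
        {p | CycStabilizable n p.1 p.2}} = {ρ : ℝ | 0 < ρ ∧ (1 : ENNReal) / 2 ≤
          quenchedLaw ν ρ.toNNReal n {p | CycStabilizable n p.1 p.2}} := by
    intro n
    ext ρ
    exact and_congr_right fun hρ => by rw [hlaw n ρ hρ]
  simp only [hset, hf, ← excess_eq_zero_iff]
  have hmono := excess_strictMonoOn hf0.le
  obtain ⟨ρs, hρs, hroot⟩ := exists_excess_eq_zero hf0 hf1
  refine ⟨ρs, ⟨hρs, hroot⟩, fun ρ hρ h => hmono.injOn hρ.le hρs.le (h.trans hroot.symm), ?_⟩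
  have hupper : ∀ a > ρs, ∀ᶠ n : ℕ in atTop, ∀ ρ ∈ {ρ : ℝ | 0 < ρ ∧ (1 : ENNReal) / 2 ≤
      quenchedLaw ν ρ.toNNReal n {p | CycStabilizable n p.1 p.2}}, ρ ≤ a := by
    intro a ha
    have hpos := hmono hρs.le (hρs.le.trans ha.le) ha
    rw [hroot] at hpos
    filter_upwards [eventually_forall_stabilizable_lt_half hshift hrestr (hρs.le.trans ha.le) hpos]
      with n hn ρ hρ
    by_contra! hlt
    exact (hn ρ.toNNReal (by rw [Real.coe_toNNReal ρ hρ.1.le]; exact hlt.le)).not_ge hρ.2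
  have hlower : ∀ a < ρs, 0 < a → ∀ᶠ n : ℕ in atTop, a ∈ {ρ : ℝ | 0 < ρ ∧ (1 : ENNReal) / 2 ≤
      quenchedLaw ν ρ.toNNReal n {p | CycStabilizable n p.1 p.2}} := by
    intro a ha ha0
    have hneg := hmono ha0.le hρs.le ha
    rw [hroot] at hneg
    filter_upwards [eventually_half_le_stabilizable hshift hrestr a.toNNReal
      (by rwa [Real.coe_toNNReal a ha0.le])] with n hn
    exact ⟨ha0, hn⟩
  refine tendsto_order.2 ⟨fun a ha => ?_, fun a ha => ?_⟩
  · obtain ⟨b, hb, hbs⟩ := exists_between (max_lt ha hρs)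
    filter_upwards [hlower b hbs ((le_max_right _ _).trans_lt hb),
      hupper (ρs + 1) (by linarith)] with n hmem hbdd
    exact ((le_max_left _ _).trans_lt hb).trans_le (le_csSup ⟨_, hbdd⟩ hmem)
  · obtain ⟨b, hbs, hb⟩ := exists_between ha
    filter_upwards [hlower (ρs / 2) (by linarith) (by linarith), hupper b hbs] with n hmem hle
    have hne : {ρ : ℝ | 0 < ρ ∧ (1 : ENNReal) / 2 ≤
      quenchedLaw ν ρ.toNNReal n {p | CycStabilizable n p.1 p.2}}.Nonempty := ⟨_, hmem⟩
    exact (csSup_le hne hle).trans_lt hb
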